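/- Let (Ω, P) be a probability space, X : Ω → ℝ^p a measurable random vector, and A : Ω → {0,1} a measurable random variable. Let T be a binary decision tree over ℝ^p with measurable test sets and leaf labels in {−1,1}. Fix α ∈ ℝ \ {0,1}. If for every decision node t of T the conditional independence of A and I*_t(X) given the event {X ∈ dom(T_t)} holds in product form (for all a ∈ {0,1}, i ∈ {0,1}: P({I*_t(X)=i} ∩ {A=a} ∩ {X ∈ dom(T_t)}) · P(X ∈ dom(T_t)) = P({I*_t(X)=i} ∩ {X ∈ dom(T_t)}) · P({A=a} ∩ {X ∈ dom(T_t)})), then the random variable T(X) is independent of A. (Theorem 3 / Theorem 8, the main result of the paper.) -/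

import Mathlib

/-- A binary decision tree over ℝ^p: either a leaf with a real label,
or a decision node with a test set and two subtrees. -/
inductive DTree (p : ℕ) : Type where
  | leaf (label : ℝ) : DTree p
  | node (S : Set (Fin p → ℝ)) (L R : DTree p) : DTree p

namespace DTree

variable {p : ℕ}

open Classical

/-- Evaluation of a decision tree: at a decision node with test set `S`,
go left if `x ∈ S`, else right; at a leaf return its label. -/
noncomputable def eval : DTree p → (Fin p → ℝ) → ℝ
  | leaf y, _ => y
  | node S L R, x => if x ∈ S then L.eval x else R.eval x

/-- The list of (label, domain) pairs of the terminal nodes (leaves) of a tree,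
where `D` is the domain of the root. -/
def leaves : DTree p → Set (Fin p → ℝ) → List (ℝ × Set (Fin p → ℝ))
  | leaf y, D => [(y, D)]
  | node S L R, D => L.leaves (D ∩ S) ++ R.leaves (D ∩ Sᶜ)

/-- The list of (domain, test set) pairs of the decision nodes of a tree,
where `D` is the domain of the root. -/
def decisions : DTree p → Set (Fin p → ℝ) → List (Set (Fin p → ℝ) × Set (Fin p → ℝ))
  | leaf _, _ => []
  | node S L R, D => (D, S) :: (L.decisions (D ∩ S) ++ R.decisions (D ∩ Sᶜ))

/-- The list of the domains of all nodes (decision and terminal) of a tree,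
where `D` is the domain of the root. -/
def nodeDoms : DTree p → Set (Fin p → ℝ) → List (Set (Fin p → ℝ))
  | leaf _, D => [D]
  | node S L R, D => D :: (L.nodeDoms (D ∩ S) ++ R.nodeDoms (D ∩ Sᶜ))

/-- All test sets of the tree are measurable. -/
def MeasurableTests : DTree p → Prop
  | leaf _ => True
  | node S L R => MeasurableSet S ∧ L.MeasurableTests ∧ R.MeasurableTests

/-- All leaf labels lie in {-1, 1}. -/
def LabelsPM : DTree p → Prop
  | leaf y => y = -1 ∨ y = 1
  | node _ L R => L.LabelsPM ∧ R.LabelsPM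

end DTree

open Classical in
/-- The extended test `I*_t` of a decision node with domain `D` and test set `S`:
it takes the value `α` outside `D` and the indicator of `S` on `D`. -/
noncomputable def extTest {p : ℕ} (α : ℝ) (D S : Set (Fin p → ℝ)) (x : Fin p → ℝ) : ℝ :=
  if x ∈ D then (if x ∈ S then 1 else 0) else α

open MeasureTheory ProbabilityTheory

theorem extTest_eq_one_inter {p : ℕ} {Ω : Type*} (X : Ω → (Fin p → ℝ)) (α : ℝ)
    (D S : Set (Fin p → ℝ)) :
    {ω | extTest α D S (X ω) = 1} ∩ {ω | X ω ∈ D} = X ⁻¹' (D ∩ S) := by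
  ext ω
  by_cases hD : X ω ∈ D <;> by_cases hS : X ω ∈ S <;> simp [extTest, hD, hS]

theorem extTest_eq_zero_inter {p : ℕ} {Ω : Type*} (X : Ω → (Fin p → ℝ)) (α : ℝ)
    (D S : Set (Fin p → ℝ)) :
    {ω | extTest α D S (X ω) = 0} ∩ {ω | X ω ∈ D} = X ⁻¹' (D ∩ Sᶜ) := by
  ext ω
  by_cases hD : X ω ∈ D <;> by_cases hS : X ω ∈ S <;> simp [extTest, hD, hS]

/-- If `E ⊆ D` is conditionally independent of `B` given `D`, and `D` is independent of `B`,
then `E` is independent of `B`. -/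
theorem measure_inter_eq_mul_of_subset {Ω : Type*} [MeasurableSpace Ω] {P : Measure Ω}
    [IsFiniteMeasure P] {B D E : Set Ω} (hED : E ⊆ D)
    (hD : P (D ∩ B) = P D * P B)
    (hE : P (E ∩ B) * P D = P E * P (D ∩ B)) :
    P (E ∩ B) = P E * P B := by
  by_cases h0 : P D = 0
  · have hE0 : P E = 0 := measure_mono_null hED h0
    rw [hE0, zero_mul, measure_mono_null Set.inter_subset_left hE0]
  · rw [hD, mul_comm (P D), ← mul_assoc] at hE
    exact (ENNReal.mul_left_inj h0 (measure_ne_top P D)).1 hE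

theorem DTree.measure_eval_inter_eq_mul {Ω : Type*} [MeasurableSpace Ω] {P : Measure Ω}
    [IsFiniteMeasure P] {p : ℕ} {X : Ω → (Fin p → ℝ)} (hX : Measurable X) (B : Set Ω)
    (V : Set ℝ) (T : DTree p) (hT : T.MeasurableTests) (D : Set (Fin p → ℝ))
    (hD : P (X ⁻¹' D ∩ B) = P (X ⁻¹' D) * P B)
    (hCond : ∀ DS ∈ T.decisions D, ∀ E ∈ ({DS.2, DS.2ᶜ} : Set (Set (Fin p → ℝ))),
      P (X ⁻¹' (DS.1 ∩ E) ∩ B) * P (X ⁻¹' DS.1)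
        = P (X ⁻¹' (DS.1 ∩ E)) * P (X ⁻¹' DS.1 ∩ B)) :
    P (X ⁻¹' (D ∩ T.eval ⁻¹' V) ∩ B) = P (X ⁻¹' (D ∩ T.eval ⁻¹' V)) * P B := by
  induction T generalizing D with
  | leaf y =>
    by_cases hy : y ∈ V
    · have h : (DTree.leaf y : DTree p).eval ⁻¹' V = Set.univ := by
        ext x; simp [DTree.eval, hy]
      rw [h, Set.inter_univ, hD]
    · have h : (DTree.leaf y : DTree p).eval ⁻¹' V = ∅ := by
        ext x; simp [DTree.eval, hy]
      simp [h]
  | node S L R ihL ihR =>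
    obtain ⟨hS, hL, hR⟩ := hT
    have hroot := hCond (D, S) (by simp [DTree.decisions])
    have hleft := ihL hL (D ∩ S)
      (measure_inter_eq_mul_of_subset (Set.preimage_mono Set.inter_subset_left) hD
        (hroot S (by simp)))
      (fun DS h => hCond DS (by simp [DTree.decisions, h]))
    have hright := ihR hR (D ∩ Sᶜ)
      (measure_inter_eq_mul_of_subset (Set.preimage_mono Set.inter_subset_left) hD
        (hroot Sᶜ (by simp)))
      (fun DS h => hCond DS (by simp [DTree.decisions, h]))
    have hinter : X ⁻¹' (D ∩ (DTree.node S L R).eval ⁻¹' V) ∩ X ⁻¹' S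
        = X ⁻¹' (D ∩ S ∩ L.eval ⁻¹' V) := by
      ext ω
      by_cases h : X ω ∈ S <;> simp [DTree.eval, h]
    have hdiff : X ⁻¹' (D ∩ (DTree.node S L R).eval ⁻¹' V) \ X ⁻¹' S
        = X ⁻¹' (D ∩ Sᶜ ∩ R.eval ⁻¹' V) := by
      ext ω
      by_cases h : X ω ∈ S <;> simp [DTree.eval, h]
    rw [← measure_inter_add_sdiff (X ⁻¹' (D ∩ _)) (hX hS),
      ← measure_inter_add_sdiff (X ⁻¹' (D ∩ _) ∩ B) (hX hS), Set.inter_right_comm,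
      Set.inter_sdiff_right_comm, hinter, hdiff, hleft, hright, add_mul]

/-- **Theorem 3 (main result): conditional independence of all decision tests from `A`
implies Statistical Parity of the tree.** If for every decision node `t` of `T` the
conditional independence of `A` and `I*_t(X)` given `{X ∈ dom(T_t)}` holds in product
form, then the random variable `T(X)` is independent of `A`. -/
theorem thm_cond_indep_tests_implies_global_parity
    {Ω : Type*} [MeasurableSpace Ω] (P : Measure Ω) [IsProbabilityMeasure P]
    {p : ℕ} (X : Ω → (Fin p → ℝ)) (hX : Measurable X)
    (A : Ω → ℝ) (hA : Measurable A) (hAval : ∀ ω, A ω = 0 ∨ A ω = 1)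
    (α : ℝ) (hα : α ∉ ({0, 1} : Set ℝ))
    (T : DTree p) (hTmeas : T.MeasurableTests) (hTlab : T.LabelsPM)
    (hCond : ∀ DS ∈ T.decisions Set.univ, ∀ a ∈ ({0, 1} : Set ℝ), ∀ i ∈ ({0, 1} : Set ℝ),
      P ({ω | extTest α DS.1 DS.2 (X ω) = i} ∩ {ω | A ω = a} ∩ {ω | X ω ∈ DS.1})
          * P {ω | X ω ∈ DS.1}
        = P ({ω | extTest α DS.1 DS.2 (X ω) = i} ∩ {ω | X ω ∈ DS.1})
          * P ({ω | A ω = a} ∩ {ω | X ω ∈ DS.1})) :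
    IndepFun (fun ω => T.eval (X ω)) A P := by
  have hsing : ∀ a ∈ ({0, 1} : Set ℝ), ∀ V : Set ℝ,
      P ((fun ω => T.eval (X ω)) ⁻¹' V ∩ {ω | A ω = a})
        = P ((fun ω => T.eval (X ω)) ⁻¹' V) * P {ω | A ω = a} := by
    intro a ha V
    have h := T.measure_eval_inter_eq_mul (P := P) hX {ω | A ω = a} V hTmeas Set.univ
      (by simp) ?_
    · rw [Set.univ_inter] at h
      exact h
    · rintro ⟨D, S⟩ hDS E (rfl | rfl)
      · have h := hCond _ hDS a ha 1 (by simp)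
        rw [Set.inter_right_comm, extTest_eq_one_inter, Set.inter_comm {ω | A ω = a}] at h
        exact h
      · have h := hCond _ hDS a ha 0 (by simp)
        rw [Set.inter_right_comm, extTest_eq_zero_inter, Set.inter_comm {ω | A ω = a}] at h
        exact h
  rw [indepFun_iff_measure_inter_preimage_eq_mul]
  intro V W _ _
  by_cases h0 : (0 : ℝ) ∈ W <;> by_cases h1 : (1 : ℝ) ∈ W
  · have h : A ⁻¹' W = Set.univ := by
      ext ω; rcases hAval ω with h | h <;> simp [h, h0, h1]
    simp [h]
  · have h : A ⁻¹' W = {ω | A ω = 0} := by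
      ext ω; rcases hAval ω with h | h <;> simp [h, h0, h1]
    rw [h, hsing 0 (by simp)]
  · have h : A ⁻¹' W = {ω | A ω = 1} := by
      ext ω; rcases hAval ω with h | h <;> simp [h, h0, h1]
    rw [h, hsing 1 (by simp)]
  · have h : A ⁻¹' W = ∅ := by
      ext ω; rcases hAval ω with h | h <;> simp [h, h0, h1]
    simp [h]
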